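/- arXiv:1905.12262 — 5 statements merged into one kernel-verified Lean document; each statement's English description precedes it below -/
import Mathlib

section
/- Let A, A′, and B be finite unions of left-closed right-open intervals in ℝ with λ(B) > 0 and B ⊆ A ∪ A′. Set p = λ(A ∩ B)/λ(B), q = λ(A′ ∩ B)/λ(B), r = λ(A ∩ A′ ∩ B)/λ(B), and define the unified error UE = −p·log₂(p) − q·log₂(q) + r·log₂(r), with the convention 0·log₂(0) = 0. Then UE = 0 if and only if B ⊆ A or B ⊆ A′. -/
open MeasureTheory Set

/-- A finite union of left-closed right-open intervals in ℝ. -/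
def IsFinIcoUnion (A : Set ℝ) : Prop :=
  ∃ (N : ℕ) (a b : Fin N → ℝ), (∀ m, a m < b m) ∧ A = ⋃ m, Set.Ico (a m) (b m)

open Filter Topology in
theorem IsFinIcoUnion.mem_nhdsGE {S : Set ℝ} (hS : IsFinIcoUnion S) {x : ℝ} (hx : x ∈ S) :
    S ∈ 𝓝[≥] x := by
  obtain ⟨N, a, b, -, rfl⟩ := hS
  obtain ⟨m, hm⟩ := mem_iUnion.1 hx
  exact mem_of_superset (Ico_mem_nhdsGE_of_mem hm) (subset_iUnion (fun m => Ico (a m) (b m)) m)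

open Filter Topology in
theorem IsFinIcoUnion.compl_mem_nhdsGE {S : Set ℝ} (hS : IsFinIcoUnion S) {x : ℝ}
    (hx : x ∉ S) : Sᶜ ∈ 𝓝[≥] x := by
  obtain ⟨N, a, b, -, rfl⟩ := hS
  rw [compl_iUnion, iInter_mem]
  intro m
  have hm : x ∉ Ico (a m) (b m) := fun h => hx (mem_iUnion.2 ⟨m, h⟩)
  rcases lt_or_ge x (a m) with h | h
  · exact mem_of_superset (mem_nhdsWithin_of_mem_nhds (Iio_mem_nhds h))
      fun y hy hy' => not_le_of_gt hy hy'.1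
  · have hb : b m ≤ x := by
      by_contra! hlt
      exact hm ⟨h, hlt⟩
    exact mem_of_superset self_mem_nhdsWithin
      fun y hy hy' => not_lt_of_ge (hb.trans hy) hy'.2

theorem IsFinIcoUnion.measurableSet {S : Set ℝ} (hS : IsFinIcoUnion S) : MeasurableSet S := by
  obtain ⟨N, a, b, -, rfl⟩ := hS
  exact MeasurableSet.iUnion fun m => measurableSet_Ico

theorem IsFinIcoUnion.volume_ne_top {S : Set ℝ} (hS : IsFinIcoUnion S) : volume S ≠ ⊤ := by
  obtain ⟨N, a, b, -, rfl⟩ := hS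
  refine ((measure_iUnion_fintype_le volume _).trans_lt ?_).ne
  simp

theorem IsFinIcoUnion.subset_of_volume_diff_eq_zero {S T : Set ℝ} (hS : IsFinIcoUnion S)
    (hT : IsFinIcoUnion T) (h : volume (S \ T) = 0) : S ⊆ T := by
  intro x hx
  by_contra hxT
  obtain ⟨u, hu, hsub⟩ := mem_nhdsGE_iff_exists_Ico_subset.1
    (Filter.inter_mem (hS.mem_nhdsGE hx) (hT.compl_mem_nhdsGE hxT))
  have h0 := measure_mono_null hsub h
  rw [Real.volume_Ico, ENNReal.ofReal_eq_zero] at h0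
  exact absurd hu (not_lt_of_ge (sub_nonpos.1 h0))

theorem IsFinIcoUnion.volume_inter_div_eq_one_iff {S T : Set ℝ} (hS : IsFinIcoUnion S)
    (hT : IsFinIcoUnion T) (hpos : 0 < volume S) :
    (volume (T ∩ S)).toReal / (volume S).toReal = 1 ↔ S ⊆ T := by
  have hSpos : 0 < (volume S).toReal := ENNReal.toReal_pos hpos.ne' hS.volume_ne_top
  rw [div_eq_one_iff_eq hSpos.ne']
  constructor
  · intro h
    refine hS.subset_of_volume_diff_eq_zero hT ?_
    have hadd := measureReal_inter_add_sdiff (μ := volume) (s := S) hT.measurableSet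
      hS.volume_ne_top
    rw [inter_comm] at hadd
    simp only [measureReal_def] at hadd
    refine ((ENNReal.toReal_eq_zero_iff _).1 (by linarith)).resolve_right ?_
    exact measure_ne_top_of_subset sdiff_subset hS.volume_ne_top
  · intro h
    rw [inter_eq_self_of_subset_right h]

theorem negMulLog_lt_add_of_add_eq_add_one {p q r : ℝ} (hr : 0 ≤ r) (hp : p < 1) (hq : q < 1)
    (h : p + q = r + 1) : Real.negMulLog r < Real.negMulLog p + Real.negMulLog q := by
  have hr1 : 0 < 1 - r := by linarith
  have hs : 0 < (1 - q) / (1 - r) := div_pos (by linarith) hr1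
  have ht : 0 < (1 - p) / (1 - r) := div_pos (by linarith) hr1
  have hst : (1 - q) / (1 - r) + (1 - p) / (1 - r) = 1 := by
    rw [← add_div, div_eq_one_iff_eq hr1.ne']
    linarith
  have hne : (1 : ℝ) ≠ r := by linarith
  have h1 := Real.strictConcaveOn_negMulLog.2 (mem_Ici.2 zero_le_one) (mem_Ici.2 hr) hne hs ht hst
  have h2 := Real.strictConcaveOn_negMulLog.2 (mem_Ici.2 zero_le_one) (mem_Ici.2 hr) hne ht hs
    ((add_comm _ _).trans hst)
  obtain rfl : q = r + 1 - p := by linarith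
  have e1 : ((1 - (r + 1 - p)) / (1 - r)) • (1 : ℝ) + ((1 - p) / (1 - r)) • r = p := by
    simp only [smul_eq_mul]
    field_simp
    ring
  have e2 : ((1 - p) / (1 - r)) • (1 : ℝ) + ((1 - (r + 1 - p)) / (1 - r)) • r = r + 1 - p := by
    simp only [smul_eq_mul]
    field_simp
    ring
  rw [e1] at h1
  rw [e2] at h2
  simp only [Real.negMulLog_one, smul_eq_mul, mul_zero, zero_add] at h1 h2
  calc Real.negMulLog r
      = ((1 - (r + 1 - p)) / (1 - r) + (1 - p) / (1 - r)) * Real.negMulLog r := by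
        rw [hst, one_mul]
    _ < _ := by linarith

theorem unified_error_eq_zero_iff_subset
    (A A' B : Set ℝ) (hA : IsFinIcoUnion A) (hA' : IsFinIcoUnion A')
    (hB : IsFinIcoUnion B) (hBpos : 0 < volume B) (hcover : B ⊆ A ∪ A')
    (p q r UE : ℝ)
    (hp : p = (volume (A ∩ B)).toReal / (volume B).toReal)
    (hq : q = (volume (A' ∩ B)).toReal / (volume B).toReal)
    (hr : r = (volume (A ∩ A' ∩ B)).toReal / (volume B).toReal)
    (hUE : UE = -p * Real.logb 2 p - q * Real.logb 2 q + r * Real.logb 2 r) :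
    UE = 0 ↔ (B ⊆ A ∨ B ⊆ A') := by
  have hBr : 0 < (volume B).toReal := ENNReal.toReal_pos hBpos.ne' hB.volume_ne_top
  have hpone : p = 1 ↔ B ⊆ A := hp ▸ hB.volume_inter_div_eq_one_iff hA hBpos
  have hqone : q = 1 ↔ B ⊆ A' := hq ▸ hB.volume_inter_div_eq_one_iff hA' hBpos
  have hple : p ≤ 1 := by
    rw [hp, div_le_one hBr]
    exact ENNReal.toReal_mono hB.volume_ne_top (measure_mono inter_subset_right)
  have hqle : q ≤ 1 := by
    rw [hq, div_le_one hBr]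
    exact ENNReal.toReal_mono hB.volume_ne_top (measure_mono inter_subset_right)
  have hr0 : 0 ≤ r := hr ▸ by positivity
  have hsum : p + q = r + 1 := by
    have h := measureReal_union_add_inter (μ := volume) (s := A ∩ B) (t := A' ∩ B)
      (hA'.measurableSet.inter hB.measurableSet)
      (measure_ne_top_of_subset inter_subset_right hB.volume_ne_top)
      (measure_ne_top_of_subset inter_subset_right hB.volume_ne_top)
    rw [← union_inter_distrib_right, inter_eq_self_of_subset_right hcover,
      ← inter_inter_distrib_right] at h
    simp only [measureReal_def] at h
    rw [hp, hq, hr]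
    field_simp
    linarith
  have hlog : 0 < Real.log 2 := Real.log_pos one_lt_two
  have hUE' : UE = (Real.negMulLog p + Real.negMulLog q - Real.negMulLog r) / Real.log 2 := by
    rw [hUE]
    simp only [Real.logb, Real.negMulLog]
    ring
  rw [← hpone, ← hqone]
  constructor
  · intro h0
    by_contra! hne
    have hlt := negMulLog_lt_add_of_add_eq_add_one hr0 (hple.lt_of_ne hne.1)
      (hqle.lt_of_ne hne.2) hsum
    have hpos := div_pos (sub_pos.2 hlt) hlog
    exact hpos.ne' (hUE' ▸ h0)
  · rintro (h1 | h1)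
    · obtain rfl : q = r := by linarith
      simp [hUE', h1]
    · obtain rfl : p = r := by linarith
      simp [hUE', h1]
end

section
/- For all real numbers p, q with 0 < p < 1, 0 < q < 1, and p + q ≥ 1, one has −p·log₂(p) − q·log₂(q) + (p+q−1)·log₂(p+q−1) > 0, where the last term is interpreted as 0 when p + q = 1. -/
/-- A strictly convex function on the nonnegative reals spreads strictly: if `x` and `y` are less
than `c` and `c ≤ x + y`, then `f x + f y < f (x + y - c) + f c`. -/
theorem StrictConvexOn.add_lt_add_of_lt {f : ℝ → ℝ} (hf : StrictConvexOn ℝ (Set.Ici 0) f)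
    {x y c : ℝ} (hc : 0 ≤ c) (hx : x < c) (hy : y < c) (hxy : c ≤ x + y) :
    f x + f y < f (x + y - c) + f c := by
  have hd : 0 < (c - x) + (c - y) := by linarith
  have hr : x + y - c ∈ Set.Ici (0 : ℝ) := by simpa using hxy
  have hne : x + y - c ≠ c := by linarith
  have ha : 0 < (c - x) / ((c - x) + (c - y)) := div_pos (by linarith) hd
  have hb : 0 < (c - y) / ((c - x) + (c - y)) := div_pos (by linarith) hd
  have hab : (c - x) / ((c - x) + (c - y)) + (c - y) / ((c - x) + (c - y)) = 1 := by
    rw [← add_div, div_self hd.ne']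
  have h₁ := hf.2 hr hc hne ha hb hab
  have h₂ := hf.2 hr hc hne hb ha (by rw [add_comm, hab])
  have hax : (c - x) / ((c - x) + (c - y)) * ((c - x) + (c - y)) = c - x :=
    div_mul_cancel₀ _ hd.ne'
  generalize (c - x) / ((c - x) + (c - y)) = a at *
  generalize (c - y) / ((c - x) + (c - y)) = b at *
  obtain rfl : b = 1 - a := by linarith
  simp only [smul_eq_mul] at h₁ h₂
  rw [show a * (x + y - c) + (1 - a) * c = x by linarith] at h₁
  rw [show (1 - a) * (x + y - c) + a * c = y by linarith] at h₂
  linarith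

theorem unified_error_pos_of_mixed
    (p q : ℝ) (hp0 : 0 < p) (hp1 : p < 1) (hq0 : 0 < q) (hq1 : q < 1)
    (hpq : 1 ≤ p + q) :
    0 < -p * Real.logb 2 p - q * Real.logb 2 q
        + (p + q - 1) * Real.logb 2 (p + q - 1) := by
  have h := Real.strictConvexOn_mul_log.add_lt_add_of_lt zero_le_one hp1 hq1 hpq
  simp only [Real.log_one, mul_zero, add_zero] at h
  have key : -p * Real.logb 2 p - q * Real.logb 2 q + (p + q - 1) * Real.logb 2 (p + q - 1)
      = ((p + q - 1) * Real.log (p + q - 1) - (p * Real.log p + q * Real.log q))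
        / Real.log 2 := by
    simp only [Real.logb]
    ring
  rw [key]
  exact div_pos (sub_pos.mpr h) (Real.log_pos one_lt_two)
end

section
/- Let n ≥ 0, let U_0, U_1, …, U_n be subsets of ℝ, and let τ_1, …, τ_n be closed intervals τ_i = [a_i, b_i] with 0 ≤ a_i ≤ b_i. Define F_n = U_n and, for 0 ≤ i < n, F_i = (F_{i+1} + τ_{i+1}) ∩ U_i, where X + Y = {x + y : x ∈ X, y ∈ Y} is the Minkowski sum. Then for every t ∈ ℝ, t ∈ F_0 if and only if there exist real numbers t_0, t_1, …, t_n with t_0 = t, t_i ∈ U_i for every 0 ≤ i ≤ n, and t_i − t_{i+1} ∈ τ_{i+1} for every 0 ≤ i < n. -/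
open Set Pointwise

/-- Membership in a backward recursion of Minkowski sums and intersections is the existence of a
chain of points whose consecutive differences lie in the prescribed sets. -/
theorem mem_minkowski_recursion_iff_exists_chain {G : Type*} [AddCommGroup G]
    (n : ℕ) (U D F : ℕ → Set G) (hFn : F n = U n)
    (hF : ∀ i, i < n → F i = (F (i + 1) + D (i + 1)) ∩ U i) (t : G) :
    t ∈ F 0 ↔ ∃ ts : ℕ → G, ts 0 = t ∧ (∀ i, i ≤ n → ts i ∈ U i) ∧
      (∀ i, i < n → ts i - ts (i + 1) ∈ D (i + 1)) := by
  induction n generalizing U D F t with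
  | zero =>
    rw [hFn]
    constructor
    · intro ht
      refine ⟨fun _ => t, rfl, fun i hi => ?_, fun i hi => absurd hi i.not_lt_zero⟩
      rwa [Nat.le_zero.mp hi]
    · rintro ⟨ts, rfl, hU, -⟩
      exact hU 0 le_rfl
  | succ n ih =>
    have tail (x : G) := ih (fun i => U (i + 1)) (fun i => D (i + 1)) (fun i => F (i + 1)) hFn
      (fun i hi => hF (i + 1) (Nat.succ_lt_succ hi)) x
    rw [hF 0 n.succ_pos]
    constructor
    · rintro ⟨⟨x, hx, y, hy, rfl⟩, hU⟩
      obtain ⟨ts, rfl, hts, hD⟩ := (tail x).mp hx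
      refine ⟨fun i => Nat.casesOn i (ts 0 + y) ts, rfl, ?_, ?_⟩
      · rintro (_ | i) hi
        · exact hU
        · exact hts i (Nat.le_of_succ_le_succ hi)
      · rintro (_ | i) hi
        · simpa using hy
        · exact hD i (Nat.lt_of_succ_lt_succ hi)
    · rintro ⟨ts, rfl, hU, hD⟩
      refine ⟨⟨ts 1, (tail (ts 1)).mpr ⟨fun i => ts (i + 1), rfl, ?_, ?_⟩, ts 0 - ts 1,
        hD 0 n.succ_pos, add_sub_cancel _ _⟩, hU 0 (Nat.zero_le _)⟩
      · exact fun i hi => hU (i + 1) (Nat.succ_le_succ hi)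
      · exact fun i hi => hD (i + 1) (Nat.succ_lt_succ hi)

theorem forward_influence_mem_iff_end_match
    (n : ℕ) (U : ℕ → Set ℝ) (a b : ℕ → ℝ)
    (hab : ∀ i, 1 ≤ i → i ≤ n → 0 ≤ a i ∧ a i ≤ b i)
    (F : ℕ → Set ℝ)
    (hFn : F n = U n)
    (hF : ∀ i, i < n → F i = (F (i + 1) + Set.Icc (a (i + 1)) (b (i + 1))) ∩ U i)
    (t : ℝ) :
    t ∈ F 0 ↔ ∃ ts : ℕ → ℝ, ts 0 = t ∧ (∀ i, i ≤ n → ts i ∈ U i) ∧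
      (∀ i, i < n → ts i - ts (i + 1) ∈ Set.Icc (a (i + 1)) (b (i + 1))) := by
  exact mem_minkowski_recursion_iff_exists_chain n U (fun i => Set.Icc (a i) (b i)) F hFn hF t
end

section
/- Let n ≥ 0, let U_0, …, U_n ⊆ ℝ, and let τ_1, …, τ_n be closed intervals τ_i = [a_i, b_i] with 0 ≤ a_i ≤ b_i. Define F_n = U_n and F_i = (F_{i+1} + τ_{i+1}) ∩ U_i for 0 ≤ i < n (Minkowski sum X + Y = {x + y : x ∈ X, y ∈ Y}). Define B_0 = F_0 and, for 1 ≤ i ≤ n, B_i = (B_{i−1} + (−τ_i)) ∩ F_i, where −[a,b] = [−b,−a]. Then for every s ∈ ℝ, s ∈ B_n if and only if there exist real numbers t_0, t_1, …, t_n with t_n = s, t_i ∈ U_i for every 0 ≤ i ≤ n, and t_i − t_{i+1} ∈ τ_{i+1} for every 0 ≤ i < n. -/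
open Set Pointwise

theorem mem_add_Icc_iff_exists_sub_mem (X : Set ℝ) (p q x : ℝ) :
    x ∈ X + Set.Icc p q ↔ ∃ y ∈ X, x - y ∈ Set.Icc p q := by
  rw [Set.mem_add]
  constructor
  · rintro ⟨y, hy, z, hz, rfl⟩
    exact ⟨y, hy, by simpa using hz⟩
  · rintro ⟨y, hy, h⟩
    exact ⟨y, hy, x - y, h, by ring⟩

theorem backward_influence_mem_iff_begin_match
    (n : ℕ) (U : ℕ → Set ℝ) (a b : ℕ → ℝ)
    (hab : ∀ i, 1 ≤ i → i ≤ n → 0 ≤ a i ∧ a i ≤ b i)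
    (F Bk : ℕ → Set ℝ)
    (hFn : F n = U n)
    (hF : ∀ i, i < n → F i = (F (i + 1) + Set.Icc (a (i + 1)) (b (i + 1))) ∩ U i)
    (hB0 : Bk 0 = F 0)
    (hBk : ∀ i, 1 ≤ i → i ≤ n →
      Bk i = (Bk (i - 1) + Set.Icc (-(b i)) (-(a i))) ∩ F i)
    (s : ℝ) :
    s ∈ Bk n ↔ ∃ ts : ℕ → ℝ, ts n = s ∧ (∀ i, i ≤ n → ts i ∈ U i) ∧
      (∀ i, i < n → ts i - ts (i + 1) ∈ Set.Icc (a (i + 1)) (b (i + 1))) := by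
  have hFU : ∀ i, i ≤ n → F i ⊆ U i := by
    intro i hi
    rcases hi.eq_or_lt with rfl | hi
    · exact hFn.subset
    · rw [hF i hi]
      exact Set.inter_subset_right
  have hBk_succ : ∀ k, k < n → ∀ x, x ∈ Bk (k + 1) ↔
      (∃ y ∈ Bk k, y - x ∈ Set.Icc (a (k + 1)) (b (k + 1))) ∧ x ∈ F (k + 1) := by
    intro k hk x
    rw [hBk (k + 1) (by lia) hk, Set.mem_inter_iff, mem_add_Icc_iff_exists_sub_mem,
      Nat.add_sub_cancel]
    have hneg : ∀ y, x - y ∈ Set.Icc (-b (k + 1)) (-a (k + 1)) ↔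
        y - x ∈ Set.Icc (a (k + 1)) (b (k + 1)) := by
      intro y
      rw [← neg_sub y x, Set.neg_mem_Icc_iff, neg_neg, neg_neg]
    simp only [hneg]
  constructor
  · have chain : ∀ k, k ≤ n → ∀ x ∈ Bk k, ∃ ts : ℕ → ℝ, ts k = x ∧ (∀ i, i ≤ k → ts i ∈ U i) ∧
        (∀ i, i < k → ts i - ts (i + 1) ∈ Set.Icc (a (i + 1)) (b (i + 1))) := by
      intro k
      induction k with
      | zero =>
        intro hk x hx
        refine ⟨fun _ => x, rfl, fun i hi => ?_, fun i hi => absurd hi (Nat.not_lt_zero i)⟩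
        obtain rfl := Nat.le_zero.mp hi
        exact hFU 0 hk (hB0 ▸ hx)
      | succ k ih =>
        intro hk x hx
        obtain ⟨⟨y, hy, hyx⟩, hxF⟩ := (hBk_succ k hk x).mp hx
        obtain ⟨ts, rfl, hU, hgap⟩ := ih (by lia) y hy
        refine ⟨Function.update ts (k + 1) x, Function.update_self .., fun i hi => ?_,
          fun i hi => ?_⟩
        · rcases hi.eq_or_lt with rfl | hi
          · rw [Function.update_self]
            exact hFU _ hk hxF
          · rw [Function.update_of_ne hi.ne]
            exact hU i (by lia)
        · rw [Function.update_of_ne hi.ne]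
          rcases (Nat.lt_succ_iff.mp hi).eq_or_lt with rfl | hi
          · rwa [Function.update_self]
          · rw [Function.update_of_ne (by lia)]
            exact hgap i hi
    exact chain n le_rfl s
  · rintro ⟨ts, rfl, hU, hgap⟩
    have hmemF : ∀ i, i ≤ n → ts i ∈ F i := by
      intro i hi
      induction hi using Nat.decreasingInduction with
      | self => exact hFn ▸ hU n le_rfl
      | of_succ k hk ih =>
        rw [hF k hk]
        exact ⟨(mem_add_Icc_iff_exists_sub_mem ..).mpr ⟨_, ih, hgap k hk⟩, hU k hk.le⟩
    have hmemB : ∀ i, i ≤ n → ts i ∈ Bk i := by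
      intro i
      induction i with
      | zero => exact fun hi => hB0 ▸ hmemF 0 hi
      | succ k ih =>
        exact fun hk => (hBk_succ k hk _).mpr ⟨⟨_, ih (by lia), hgap k hk⟩, hmemF _ hk⟩
    exact hmemB n le_rfl
end

section
/- Let n ≥ 0 and for each 0 ≤ i ≤ n let {U_i^m : m ∈ M_i} be a family of subsets of ℝ with union V_i = ⋃_{m ∈ M_i} U_i^m; let τ_1, …, τ_n be closed intervals [a_i, b_i] with 0 ≤ a_i ≤ b_i. For a selection σ choosing σ(i) ∈ M_i for each i, define F_n^σ = U_n^{σ(n)} and F_i^σ = (F_{i+1}^σ + τ_{i+1}) ∩ U_i^{σ(i)}; define also G_n = V_n and G_i = (G_{i+1} + τ_{i+1}) ∩ V_i (Minkowski sums). Then ⋃_σ F_0^σ = G_0, where the union is over all selections σ. -/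
open Set Pointwise

theorem influence_set_eq_forward_influence_of_unions
    (n : ℕ) (κ : ℕ → Type*) (U : (i : ℕ) → κ i → Set ℝ)
    (V : ℕ → Set ℝ) (hV : ∀ i, V i = ⋃ m : κ i, U i m)
    (a b : ℕ → ℝ) (hab : ∀ i, 1 ≤ i → i ≤ n → 0 ≤ a i ∧ a i ≤ b i)
    (Fσ : ((i : {j : ℕ // j ≤ n}) → κ i.val) → ℕ → Set ℝ)
    (hFσn : ∀ σ, Fσ σ n = U n (σ ⟨n, le_refl n⟩))
    (hFσ : ∀ σ, ∀ i, (h : i < n) → Fσ σ i =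
      (Fσ σ (i + 1) + Set.Icc (a (i + 1)) (b (i + 1))) ∩ U i (σ ⟨i, le_of_lt h⟩))
    (G : ℕ → Set ℝ)
    (hGn : G n = V n)
    (hG : ∀ i, i < n → G i = (G (i + 1) + Set.Icc (a (i + 1)) (b (i + 1))) ∩ V i) :
    (⋃ σ : (i : {j : ℕ // j ≤ n}) → κ i.val, Fσ σ 0) = G 0 := by
  have hUV : ∀ i (m : κ i), U i m ⊆ V i := fun i m => by
    rw [hV]; exact subset_iUnion (U i) m
  have F_subset : ∀ σ i, i ≤ n → Fσ σ i ⊆ G i := by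
    intro σ i hi
    induction hi using Nat.decreasingInduction with
    | self => rw [hFσn, hGn]; exact hUV _ _
    | of_succ i hi ih =>
      rw [hFσ σ i hi, hG i hi]
      exact inter_subset_inter (add_subset_add_right ih) (hUV _ _)
  -- A point of `G i` is reached by every selection extending a suitable one on `[i, n]`.
  have exists_partial : ∀ i, i ≤ n → ∀ x ∈ G i, ∃ s : (j : ℕ) → i ≤ j → j ≤ n → κ j,
      ∀ σ : (j : {j : ℕ // j ≤ n}) → κ j.val,
        (∀ j (hij : i ≤ j) (hjn : j ≤ n), σ ⟨j, hjn⟩ = s j hij hjn) → x ∈ Fσ σ i := by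
    intro i hi
    induction hi using Nat.decreasingInduction with
    | self =>
      intro x hx
      rw [hGn, hV] at hx
      obtain ⟨m, hm⟩ := mem_iUnion.1 hx
      refine ⟨fun j h₁ h₂ => le_antisymm h₁ h₂ ▸ m, fun σ hσ => ?_⟩
      rw [hFσn, hσ n le_rfl le_rfl]
      exact hm
    | of_succ i hi ih =>
      intro x hx
      rw [hG i hi, hV] at hx
      obtain ⟨⟨y, hy, t, ht, rfl⟩, hxV⟩ := hx
      obtain ⟨m, hm⟩ := mem_iUnion.1 hxV
      obtain ⟨s, hs⟩ := ih y hy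
      refine ⟨fun j h₁ h₂ => if h : i = j then h ▸ m else s j (by omega) h₂,
        fun σ hσ => ?_⟩
      rw [hFσ σ i hi]
      refine ⟨add_mem_add (hs σ fun j hij hjn => ?_) ht, ?_⟩
      · exact (hσ j (by omega) hjn).trans (dif_neg (by omega))
      · rw [(hσ i le_rfl hi.le).trans (dif_pos rfl)]
        exact hm
  refine Subset.antisymm (iUnion_subset fun σ => F_subset σ 0 n.zero_le) fun x hx => ?_
  obtain ⟨s, hs⟩ := exists_partial 0 n.zero_le x hx
  exact mem_iUnion.2 ⟨fun j => s j.val j.val.zero_le j.property, hs _ fun _ _ _ => rfl⟩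
end
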